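/- arXiv:2411.01222 — 4 statements merged into one kernel-verified Lean document; each statement's English description precedes it below -/
import Mathlib

section
/- For every λ ∈ (0,1), the tilted distribution Q_λ satisfies the Lagrangian stationarity equation with multiplier μ = 1/λ: there exists ν ∈ ℝ such that for every y ∈ Σ, −(log(Q_λ(y) / P_w y) + 1) + (1/λ)·(log(Q_λ(y) / P_f y) + 1) + ν = 0. -/
open Real Finset

/-- For every `λ ∈ (0,1)` the tilted distribution `Q_λ` satisfies the Lagrangian
stationarity equation with multiplier `μ = 1/λ` for some `ν ∈ ℝ`. -/
theorem stmt_2 {V : Type*} [Fintype V] [Nonempty V]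
    (Pw Pf : V → ℝ)
    (hPw_pos : ∀ y, 0 < Pw y) (hPw_sum : ∑ y, Pw y = 1)
    (hPf_pos : ∀ y, 0 < Pf y) (hPf_sum : ∑ y, Pf y = 1)
    (l : ℝ) (hl : l ∈ Set.Ioo (0 : ℝ) 1) :
    ∃ ν : ℝ, ∀ y,
      -(Real.log (((Pf y) ^ (1 / (1 - l)) * (Pw y) ^ (-(l / (1 - l))) /
          (∑ z, (Pf z) ^ (1 / (1 - l)) * (Pw z) ^ (-(l / (1 - l))))) / Pw y) + 1)
      + (1 / l) * (Real.log (((Pf y) ^ (1 / (1 - l)) * (Pw y) ^ (-(l / (1 - l))) /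
          (∑ z, (Pf z) ^ (1 / (1 - l)) * (Pw z) ^ (-(l / (1 - l))))) / Pf y) + 1)
      + ν = 0 := by
  obtain ⟨hl0, hl1⟩ := hl
  have hl_ne : l ≠ 0 := hl0.ne'
  have hl_sub : 1 - l ≠ 0 := (sub_pos.mpr hl1).ne'
  have h_term : ∀ y, 0 < Pf y ^ (1 / (1 - l)) * Pw y ^ (-(l / (1 - l))) := fun y =>
    mul_pos (Real.rpow_pos_of_pos (hPf_pos y) _) (Real.rpow_pos_of_pos (hPw_pos y) _)
  have hZ : 0 < ∑ z, Pf z ^ (1 / (1 - l)) * Pw z ^ (-(l / (1 - l))) :=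
    Finset.sum_pos (fun z _ => h_term z) Finset.univ_nonempty
  generalize (∑ z, Pf z ^ (1 / (1 - l)) * Pw z ^ (-(l / (1 - l)))) = Z at hZ ⊢
  refine ⟨(1 / l - 1) * (Real.log Z - 1), fun y => ?_⟩
  have hQ := div_pos (h_term y) hZ
  rw [Real.log_div hQ.ne' (hPw_pos y).ne', Real.log_div hQ.ne' (hPf_pos y).ne',
    Real.log_div (h_term y).ne' hZ.ne',
    Real.log_mul (Real.rpow_pos_of_pos (hPf_pos y) _).ne'
      (Real.rpow_pos_of_pos (hPw_pos y) _).ne',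
    Real.log_rpow (hPf_pos y), Real.log_rpow (hPw_pos y)]
  field_simp
  ring
end

section
/- Let Q : Σ → ℝ be a positive pmf and suppose Q satisfies the Lagrangian stationarity equation with multipliers μ, ν ∈ ℝ where μ ≠ 1, i.e., for every y ∈ Σ: −(log(Q y / P_w y) + 1) + μ·(log(Q y / P_f y) + 1) + ν = 0. Then there exists a constant c > 0 such that for every y ∈ Σ, Q y = c · (P_f y)^{μ/(μ−1)} · (P_w y)^{1/(1−μ)}. -/
open Real Finset

/-- Any positive pmf satisfying the Lagrangian stationarity equation with
multipliers `μ ≠ 1`, `ν` is a geometric mixture of `P_f` and `P_w`. -/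
theorem stmt_3 {V : Type*} [Fintype V] [Nonempty V]
    (Pw Pf : V → ℝ)
    (hPw_pos : ∀ y, 0 < Pw y) (hPw_sum : ∑ y, Pw y = 1)
    (hPf_pos : ∀ y, 0 < Pf y) (hPf_sum : ∑ y, Pf y = 1)
    (Q : V → ℝ) (hQ_pos : ∀ y, 0 < Q y) (hQ_sum : ∑ y, Q y = 1)
    (μ ν : ℝ) (hμ : μ ≠ 1)
    (hstat : ∀ y, -(Real.log (Q y / Pw y) + 1) + μ * (Real.log (Q y / Pf y) + 1) + ν = 0) :
    ∃ c : ℝ, 0 < c ∧ ∀ y, Q y = c * (Pf y) ^ (μ / (μ - 1)) * (Pw y) ^ (1 / (1 - μ)) := by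
  have h₁ : μ - 1 ≠ 0 := sub_ne_zero.mpr hμ
  refine ⟨Real.exp ((1 - μ - ν) / (μ - 1)), Real.exp_pos _, fun y => ?_⟩
  have h := hstat y
  rw [Real.log_div (hQ_pos y).ne' (hPw_pos y).ne',
    Real.log_div (hQ_pos y).ne' (hPf_pos y).ne'] at h
  rw [Real.rpow_def_of_pos (hPf_pos y), Real.rpow_def_of_pos (hPw_pos y),
    ← Real.exp_add, ← Real.exp_add, ← neg_sub μ 1, div_neg, ← Real.exp_log (hQ_pos y)]
  congr 1
  field_simp
  linarith
end

section
/- Let Q : Σ → ℝ be a positive pmf satisfying the Lagrangian stationarity equation with multipliers μ, ν ∈ ℝ where μ > 1. Set λ := 1/μ, so λ ∈ (0,1). Then Q equals the tilted distribution Q_λ: for every y ∈ Σ, Q y = (P_f y)^{1/(1−λ)} · (P_w y)^{−λ/(1−λ)} / Z_λ, where Z_λ := ∑_{y∈Σ} (P_f y)^{1/(1−λ)} · (P_w y)^{−λ/(1−λ)}. -/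
open Real Finset

/-- A positive solution of the stationarity equation at a point is an explicit constant times a
product of powers of the two reference weights. -/
lemma eq_exp_mul_rpow_of_stationary {w f q μ ν : ℝ} (hw : 0 < w) (hf : 0 < f) (hq : 0 < q)
    (hμ : μ - 1 ≠ 0)
    (h : -(Real.log (q / w) + 1) + μ * (Real.log (q / f) + 1) + ν = 0) :
    q = Real.exp ((1 - μ - ν) / (μ - 1)) * (f ^ (μ / (μ - 1)) * w ^ (-(1 / (μ - 1)))) := by
  rw [Real.log_div hq.ne' hw.ne', Real.log_div hq.ne' hf.ne'] at h
  rw [Real.rpow_def_of_pos hf, Real.rpow_def_of_pos hw, ← Real.exp_add, ← Real.exp_add]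
  refine (Real.exp_log hq).symm.trans (congrArg Real.exp ?_)
  field_simp
  linear_combination h

/-- A function summing to one and proportional to `g` is the normalization of `g`. -/
lemma eq_div_sum_of_eq_const_mul {ι K : Type*} [Fintype ι] [Field K] {q g : ι → K} {c : K}
    (hsum : ∑ i, q i = 1) (h : ∀ i, q i = c * g i) (i : ι) : q i = g i / ∑ j, g j := by
  have hc : c * ∑ j, g j = 1 := by
    rw [Finset.mul_sum, ← hsum]
    exact Finset.sum_congr rfl fun j _ => (h j).symm
  rw [eq_div_iff (right_ne_zero_of_mul_eq_one hc), h i]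
  linear_combination g i * hc

/-- A positive pmf satisfying the Lagrangian stationarity equation with
multiplier `μ > 1` equals the tilted distribution `Q_λ` with `λ = 1/μ`. -/
theorem stmt_4 {V : Type*} [Fintype V] [Nonempty V]
    (Pw Pf : V → ℝ)
    (hPw_pos : ∀ y, 0 < Pw y) (hPw_sum : ∑ y, Pw y = 1)
    (hPf_pos : ∀ y, 0 < Pf y) (hPf_sum : ∑ y, Pf y = 1)
    (Q : V → ℝ) (hQ_pos : ∀ y, 0 < Q y) (hQ_sum : ∑ y, Q y = 1)
    (μ ν : ℝ) (hμ : 1 < μ)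
    (hstat : ∀ y, -(Real.log (Q y / Pw y) + 1) + μ * (Real.log (Q y / Pf y) + 1) + ν = 0) :
    (1 / μ) ∈ Set.Ioo (0 : ℝ) 1 ∧
    ∀ y, Q y = (Pf y) ^ (1 / (1 - 1 / μ)) * (Pw y) ^ (-((1 / μ) / (1 - 1 / μ))) /
        (∑ z, (Pf z) ^ (1 / (1 - 1 / μ)) * (Pw z) ^ (-((1 / μ) / (1 - 1 / μ)))) := by
  have hμ0 : 0 < μ := by linarith
  refine ⟨⟨by positivity, (div_lt_one hμ0).2 hμ⟩, fun y => ?_⟩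
  have hμ1 : μ - 1 ≠ 0 := by linarith
  have ha : 1 / (1 - 1 / μ) = μ / (μ - 1) := by field_simp
  have hb : (1 / μ) / (1 - 1 / μ) = 1 / (μ - 1) := by field_simp
  rw [ha, hb]
  exact eq_div_sum_of_eq_const_mul hQ_sum
    (fun z => eq_exp_mul_rpow_of_stationary (hPw_pos z) (hPf_pos z) (hQ_pos z) hμ1 (hstat z)) y
end

section
/- Suppose Σ has at least two elements and ε > 0. Let Q* : Σ → ℝ be everywhere positive, lie in the feasible set S_ε, and be a local minimum of the scrubbing objective on S_ε (formally: IsLocalMinOn (fun Q => −∑_{y} Q y · log(Q y / P_w y)) S_ε Q*). Then the fidelity constraint is active at Q*: KL(Q*‖P_f) = ε. -/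
open Real Finset

/-- `x ↦ x * log (x / p)` is strictly convex on `[0, ∞)`. -/
lemma strictConvexOn_mul_log_div {p : ℝ} (hp : 0 < p) :
    StrictConvexOn ℝ (Set.Ici 0) fun x : ℝ => x * Real.log (x / p) := by
  refine (Real.strictConvexOn_mul_log.add_convexOn
    ((LinearMap.mulRight ℝ (-Real.log p)).convexOn (convex_Ici 0))).congr ?_
  intro x _
  rcases eq_or_ne x 0 with rfl | hx
  · simp
  · simp [Real.log_div hx hp.ne']
    ring

lemma continuous_mul_log_div {p : ℝ} (hp : 0 < p) :
    Continuous fun x : ℝ => x * Real.log (x / p) := by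
  refine ((Real.continuous_mul_log.comp (continuous_id.div_const p)).const_mul p).congr ?_
  intro x
  simp only [Function.comp_apply, id_eq]
  field_simp

/-- The relative entropy `Q ↦ KL(Q‖P)` is strictly convex on the nonnegative orthant. -/
lemma strictConvexOn_sum_mul_log_div {V : Type*} [Fintype V] {P : V → ℝ} (hP : ∀ y, 0 < P y) :
    StrictConvexOn ℝ (Set.Ici 0) fun Q : V → ℝ => ∑ y, Q y * Real.log (Q y / P y) := by
  refine ⟨convex_Ici 0, ?_⟩
  intro Q hQ R hR hne a b ha hb hab
  simp only [smul_eq_mul, Finset.mul_sum, ← Finset.sum_add_distrib]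
  obtain ⟨v, hv⟩ := Function.ne_iff.mp hne
  refine Finset.sum_lt_sum (fun y _ => ?_) ⟨v, Finset.mem_univ v, ?_⟩
  · exact (strictConvexOn_mul_log_div (hP y)).convexOn.2 (hQ y) (hR y) ha.le hb.le hab
  · exact (strictConvexOn_mul_log_div (hP v)).2 (hQ v) (hR v) hv ha hb hab

lemma continuous_sum_mul_log_div {V : Type*} [Fintype V] {P : V → ℝ} (hP : ∀ y, 0 < P y) :
    Continuous fun Q : V → ℝ => ∑ y, Q y * Real.log (Q y / P y) :=
  continuous_finsetSum _ fun y _ => (continuous_mul_log_div (hP y)).comp (continuous_apply y)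

/-- The negative of a strictly convex function has no local minimum on `s` at a point `x` near
which `s` contains a segment centred at `x`. -/
lemma StrictConvexOn.not_isLocalMinOn_neg {E : Type*} [AddCommGroup E] [Module ℝ E]
    [TopologicalSpace E] [ContinuousAdd E] [ContinuousSMul ℝ E] {C s : Set E} {f : E → ℝ}
    (hf : StrictConvexOn ℝ C f) (hsC : s ⊆ C) {x d : E} (hd : d ≠ 0)
    (hs : ∀ᶠ t : ℝ in nhds 0, x + t • d ∈ s) :
    ¬ IsLocalMinOn (fun z => -f z) s x := by
  intro hmin
  have hcurve : Filter.Tendsto (fun t : ℝ => x + t • d) (nhds 0) (nhdsWithin x s) := by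
    refine tendsto_nhdsWithin_iff.mpr ⟨?_, hs⟩
    have hc : Continuous fun t : ℝ => x + t • d := by fun_prop
    simpa using hc.tendsto 0
  have hpos : ∀ᶠ t : ℝ in nhds 0, x + t • d ∈ s ∧ f (x + t • d) ≤ f x := by
    filter_upwards [hs, hcurve.eventually hmin] with t ht hle
    exact ⟨ht, neg_le_neg_iff.mp hle⟩
  have hneg : ∀ᶠ t : ℝ in nhds 0, x + (-t) • d ∈ s ∧ f (x + (-t) • d) ≤ f x := by
    have hn : Filter.Tendsto (fun t : ℝ => -t) (nhds 0) (nhds 0) := by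
      simpa using (continuous_neg (G := ℝ)).tendsto 0
    exact hn.eventually hpos
  obtain ⟨t, ⟨⟨hts, htle⟩, hts', htle'⟩, (ht0 : 0 < t)⟩ :=
    (((hpos.and hneg).filter_mono nhdsWithin_le_nhds).and
      (self_mem_nhdsWithin (s := Set.Ioi (0 : ℝ)))).exists
  have hne : x + t • d ≠ x + (-t) • d := by
    intro h
    have h' := smul_left_injective ℝ hd (add_left_cancel h)
    linarith
  have hlt := hf.2 (hsC hts) (hsC hts') hne
    (one_half_pos (α := ℝ)) (one_half_pos (α := ℝ)) (add_halves 1)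
  have hmid : (1 / 2 : ℝ) • (x + t • d) + (1 / 2 : ℝ) • (x + (-t) • d) = x := by module
  rw [hmid, smul_eq_mul, smul_eq_mul] at hlt
  linarith

/-- Active constraint: an everywhere-positive local minimum of the scrubbing
objective `Q ↦ -KL(Q‖P_w)` on `S_ε` satisfies `KL(Q*‖P_f) = ε`. -/
theorem stmt_11 {V : Type*} [Fintype V] [Nonempty V] (hcard : 1 < Fintype.card V)
    (Pw Pf : V → ℝ)
    (hPw_pos : ∀ y, 0 < Pw y) (hPw_sum : ∑ y, Pw y = 1)
    (hPf_pos : ∀ y, 0 < Pf y) (hPf_sum : ∑ y, Pf y = 1)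
    (ε : ℝ) (hε : 0 < ε)
    (Q : V → ℝ) (hQ_pos : ∀ y, 0 < Q y)
    (hQ_feas : Q ∈ {Q : V → ℝ | Q ∈ stdSimplex ℝ V ∧
      ∑ y, Q y * Real.log (Q y / Pf y) ≤ ε})
    (hmin : IsLocalMinOn (fun Q : V → ℝ => -∑ y, Q y * Real.log (Q y / Pw y))
      {Q : V → ℝ | Q ∈ stdSimplex ℝ V ∧ ∑ y, Q y * Real.log (Q y / Pf y) ≤ ε} Q) :
    ∑ y, Q y * Real.log (Q y / Pf y) = ε := by
  classical
  refine le_antisymm hQ_feas.2 (not_lt.mp fun hlt => ?_)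
  obtain ⟨a, b, hab⟩ := Fintype.one_lt_card_iff.mp hcard
  set d : V → ℝ := Pi.single a 1 - Pi.single b 1 with hd
  have hd0 : d ≠ 0 := fun h => by simpa [hd, hab] using congrFun h a
  have hdsum : ∑ y, d y = 0 := by simp [hd]
  refine (strictConvexOn_sum_mul_log_div hPw_pos).not_isLocalMinOn_neg
    (fun R hR => hR.1.1) hd0 ?_ hmin
  have hcurve : Filter.Tendsto (fun t : ℝ => Q + t • d) (nhds 0) (nhds Q) := by
    have hc : Continuous fun t : ℝ => Q + t • d := by fun_prop
    simpa using hc.tendsto 0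
  have heventually_pos : ∀ᶠ R in nhds Q, ∀ y, 0 < R y :=
    Filter.eventually_all.mpr fun y =>
      (continuous_apply y).continuousAt.eventually_const_lt (hQ_pos y)
  have hkl : ∀ᶠ R in nhds Q, ∑ y, R y * Real.log (R y / Pf y) < ε :=
    (continuous_sum_mul_log_div hPf_pos).continuousAt.eventually_lt_const hlt
  filter_upwards [hcurve.eventually heventually_pos, hcurve.eventually hkl] with t ht hkt
  refine ⟨⟨fun y => (ht y).le, ?_⟩, hkt.le⟩
  simp [Finset.sum_add_distrib, ← Finset.mul_sum, hdsum, hQ_feas.1.2]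
end
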